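/- Robustness under admixture of the entropic entanglement parameter: for all states ρ and σ on C^d ⊗ C^d (d ≥ 2) and all 0 ≤ ε ≤ 1, |M(ρ) − M((1−ε)·ρ + ε·σ)| ≤ 4·ε·log₂ d + H₂(ε), where H₂(ε) = −ε·log₂ ε − (1−ε)·log₂(1−ε). -/

import Mathlib

open Matrix Kronecker BigOperators ComplexOrder

noncomputable section

namespace EEP

/-- `-(x * log₂ x)`; note `Real.logb 2 0 = 0`, giving the convention `0·log₂ 0 = 0`. -/
def negMulLog2 (x : ℝ) : ℝ := -(x * Real.logb 2 x)

/-- Shannon entropy (base 2) of a finite family of reals. -/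
def shannon {n : Type*} [Fintype n] (p : n → ℝ) : ℝ := ∑ i, negMulLog2 (p i)

/-- A quantum state: positive semidefinite (hence Hermitian) matrix with trace 1. -/
def IsState {n : Type*} [Fintype n] [DecidableEq n] (ρ : Matrix n n ℂ) : Prop :=
  ρ.PosSemidef ∧ ρ.trace = 1

/-- A rank-one orthogonal projection matrix. -/
def IsRankOneProj {n : Type*} [Fintype n] [DecidableEq n] (P : Matrix n n ℂ) : Prop :=
  P.IsHermitian ∧ P * P = P ∧ P.rank = 1

/-- A von Neumann measurement on `C^d ⊗ C^d`: a family of `d²` rank-one orthogonal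
projections, mutually orthogonal, summing to the identity. -/
def IsMeasurement {d : ℕ} (P : Fin (d^2) → Matrix (Fin d × Fin d) (Fin d × Fin d) ℂ) : Prop :=
  (∀ i, IsRankOneProj (P i)) ∧ (∀ i j, i ≠ j → P i * P j = 0) ∧ (∑ i, P i) = 1

/-- Klein entropy: Shannon entropy of the outcome distribution `pᵢ = Tr(ρ Pᵢ)`. -/
def kleinEntropy {d : ℕ} (ρ : Matrix (Fin d × Fin d) (Fin d × Fin d) ℂ)
    (P : Fin (d^2) → Matrix (Fin d × Fin d) (Fin d × Fin d) ℂ) : ℝ :=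
  shannon (fun i => (ρ * P i).trace.re)

/-- A product state: Kronecker product of two states on `C^d`. -/
def IsProductState {d : ℕ} (δ : Matrix (Fin d × Fin d) (Fin d × Fin d) ℂ) : Prop :=
  ∃ σA σB : Matrix (Fin d) (Fin d) ℂ, IsState σA ∧ IsState σB ∧ δ = σA ⊗ₖ σB

/-- Infimum of the Klein entropy over product states, for a fixed measurement. -/
def infProd {d : ℕ} (P : Fin (d^2) → Matrix (Fin d × Fin d) (Fin d × Fin d) ℂ) : ℝ :=
  sInf {x : ℝ | ∃ δ, IsProductState δ ∧ x = kleinEntropy δ P}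

/-- The entropic entanglement parameter
`M(ρ) = sup_P ( inf_{δ product} H(δ,P) − H(ρ,P) )`. -/
def eep {d : ℕ} (ρ : Matrix (Fin d × Fin d) (Fin d × Fin d) ℂ) : ℝ :=
  sSup {x : ℝ | ∃ P, IsMeasurement P ∧ x = infProd P - kleinEntropy ρ P}

/-- A separable state: finite convex combination of product states. -/
def IsSeparable {d : ℕ} (ρ : Matrix (Fin d × Fin d) (Fin d × Fin d) ℂ) : Prop :=
  ∃ (m : ℕ) (p : Fin m → ℝ) (δ : Fin m → Matrix (Fin d × Fin d) (Fin d × Fin d) ℂ),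
    (∀ i, 0 ≤ p i) ∧ (∑ i, p i) = 1 ∧ (∀ i, IsProductState (δ i)) ∧
    ρ = ∑ i, (p i : ℂ) • δ i

/-- Rank-one projection `|v⟩⟨v|` onto a vector `v`. -/
def projVec {n : Type*} (v : n → ℂ) : Matrix n n ℂ := Matrix.vecMulVec v (star v)

/-- Coefficient matrix `A` of a vector `ψ ∈ C^d ⊗ C^d`, `A i j = ψ (i,j)`. -/
def coeffMat {d : ℕ} (ψ : Fin d × Fin d → ℂ) : Matrix (Fin d) (Fin d) ℂ :=
  Matrix.of fun i j => ψ (i, j)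

/-- The squared Schmidt coefficients of `ψ`: the eigenvalues of `A Aᴴ`
where `A` is the coefficient matrix of `ψ`. -/
def schmidtSq {d : ℕ} (ψ : Fin d × Fin d → ℂ) : Fin d → ℝ :=
  (Matrix.isHermitian_mul_conjTranspose_self (coeffMat ψ)).eigenvalues

/-- Largest squared Schmidt coefficient (square of the largest singular value of `A`). -/
def maxSchmidtSq {d : ℕ} (ψ : Fin d × Fin d → ℂ) : ℝ := ⨆ i, schmidtSq ψ i

/-- A unit vector. -/
def IsUnitVec {n : Type*} [Fintype n] (ψ : n → ℂ) : Prop := (∑ p, Complex.normSq (ψ p)) = 1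

/-- A maximally entangled unit vector: all squared Schmidt coefficients equal `1/d`. -/
def IsMaxEntVec {d : ℕ} (ψ : Fin d × Fin d → ℂ) : Prop :=
  IsUnitVec ψ ∧ ∀ i, schmidtSq ψ i = 1 / d

/-- A von Neumann measurement in a maximally entangled basis. -/
def IsMaxEntMeasurement {d : ℕ}
    (P : Fin (d^2) → Matrix (Fin d × Fin d) (Fin d × Fin d) ℂ) : Prop :=
  IsMeasurement P ∧ ∀ i, ∃ ψ, IsMaxEntVec ψ ∧ P i = projVec ψ

/-- Von Neumann entropy: Shannon entropy of the eigenvalues. -/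
def vnEntropy {n : Type*} [Fintype n] [DecidableEq n] {ρ : Matrix n n ℂ}
    (h : ρ.IsHermitian) : ℝ := shannon h.eigenvalues

/-- Binary Shannon entropy. -/
def binEnt (x : ℝ) : ℝ := negMulLog2 x + negMulLog2 (1 - x)

lemma nml_eq (x : ℝ) : negMulLog2 x = Real.negMulLog x / Real.log 2 := by
  simp only [negMulLog2, Real.negMulLog, Real.logb]; ring

lemma log2_pos : 0 < Real.log 2 := Real.log_pos (by norm_num)

lemma nml_nonneg {x : ℝ} (h0 : 0 ≤ x) (h1 : x ≤ 1) : 0 ≤ negMulLog2 x := by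
  rw [nml_eq]; exact div_nonneg (Real.negMulLog_nonneg h0 h1) log2_pos.le

lemma nml_mul (x y : ℝ) :
    negMulLog2 (x * y) = y * negMulLog2 x + x * negMulLog2 y := by
  simp only [nml_eq, Real.negMulLog_mul]; ring

lemma nml_add_le {x y : ℝ} (hx : 0 ≤ x) (hy : 0 ≤ y) :
    negMulLog2 (x + y) ≤ negMulLog2 x + negMulLog2 y := by
  simp only [nml_eq, ← add_div]
  refine div_le_div_of_nonneg_right ?_ log2_pos.le
  rcases hx.eq_or_lt with rfl | hx'
  · simp
  rcases hy.eq_or_lt with rfl | hy'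
  · simp
  have h1 : Real.log x ≤ Real.log (x + y) := Real.log_le_log hx' (by linarith)
  have h2 : Real.log y ≤ Real.log (x + y) := Real.log_le_log hy' (by linarith)
  simp only [Real.negMulLog]
  nlinarith [mul_le_mul_of_nonneg_left h1 hx, mul_le_mul_of_nonneg_left h2 hy]

lemma nml_concave {x y a : ℝ} (hx : 0 ≤ x) (hy : 0 ≤ y) (h0 : 0 ≤ a) (h1 : a ≤ 1) :
    (1 - a) * negMulLog2 x + a * negMulLog2 y ≤ negMulLog2 ((1 - a) * x + a * y) := by
  have h := Real.concaveOn_negMulLog.2 (Set.mem_Ici.2 hx) (Set.mem_Ici.2 hy)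
    (sub_nonneg.2 h1) h0 (sub_add_cancel 1 a)
  simp only [smul_eq_mul] at h
  simp only [nml_eq]
  have := div_le_div_of_nonneg_right h log2_pos.le
  calc _ = ((1 - a) * Real.negMulLog x + a * Real.negMulLog y) / Real.log 2 := by ring
    _ ≤ _ := this

lemma shannon_nonneg {n : Type*} [Fintype n] {p : n → ℝ} (h0 : ∀ i, 0 ≤ p i)
    (h1 : ∑ i, p i = 1) : 0 ≤ shannon p := by
  refine Finset.sum_nonneg fun i _ => nml_nonneg (h0 i) ?_
  rw [← h1]
  exact Finset.single_le_sum (fun j _ => h0 j) (Finset.mem_univ i)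

lemma shannon_le {N : ℕ} (hN : 0 < N) {p : Fin N → ℝ} (h0 : ∀ i, 0 ≤ p i)
    (h1 : ∑ i, p i = 1) : shannon p ≤ Real.logb 2 N := by
  have hN' : (0 : ℝ) < N := by exact_mod_cast hN
  have key : ∀ i, Real.negMulLog (p i) ≤ p i * Real.log N + (1 / N - p i) := by
    intro i
    rcases (h0 i).eq_or_lt with h | h
    · rw [← h]; simp
    have := Real.log_le_sub_one_of_pos (x := 1 / (N * p i)) (by positivity)
    rw [Real.log_div one_ne_zero (by positivity), Real.log_mul hN'.ne' h.ne', Real.log_one] at this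
    have h2 := mul_le_mul_of_nonneg_left this h.le
    have h3 : p i * (1 / (N * p i) - 1) = 1 / N - p i := by field_simp
    rw [h3] at h2
    simp only [Real.negMulLog]
    linarith
  have hs := Finset.sum_le_sum (s := Finset.univ) fun i _ => key i
  rw [Finset.sum_add_distrib, Finset.sum_sub_distrib, ← Finset.sum_mul, h1] at hs
  have hc : ∑ _i : Fin N, (1 : ℝ) / N = 1 := by
    simp; field_simp
  rw [hc] at hs
  simp only [shannon, nml_eq, ← Finset.sum_div, Real.logb]
  exact div_le_div_of_nonneg_right (by linarith) log2_pos.le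

lemma shannon_mix_le {N : ℕ} {p q : Fin N → ℝ} (hp : ∀ i, 0 ≤ p i) (hq : ∀ i, 0 ≤ q i)
    (hp1 : ∑ i, p i = 1) (hq1 : ∑ i, q i = 1) {a : ℝ} (h0 : 0 ≤ a) (h1 : a ≤ 1) :
    shannon (fun i => (1 - a) * p i + a * q i) ≤
      (1 - a) * shannon p + a * shannon q + binEnt a := by
  have h : ∀ i, negMulLog2 ((1 - a) * p i + a * q i) ≤
      (p i * negMulLog2 (1 - a) + (1 - a) * negMulLog2 (p i)) +
      (q i * negMulLog2 a + a * negMulLog2 (q i)) := by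
    intro i
    rw [← nml_mul, ← nml_mul]
    exact nml_add_le (mul_nonneg (by linarith) (hp i)) (mul_nonneg h0 (hq i))
  have hs := Finset.sum_le_sum (s := Finset.univ) fun i _ => h i
  simp only [Finset.sum_add_distrib, ← Finset.sum_mul, ← Finset.mul_sum, hp1, hq1] at hs
  simp only [shannon, binEnt]
  linarith

lemma le_shannon_mix {N : ℕ} {p q : Fin N → ℝ} (hp : ∀ i, 0 ≤ p i) (hq : ∀ i, 0 ≤ q i)
    {a : ℝ} (h0 : 0 ≤ a) (h1 : a ≤ 1) :
    (1 - a) * shannon p + a * shannon q ≤ shannon (fun i => (1 - a) * p i + a * q i) := by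
  have hs := Finset.sum_le_sum (s := Finset.univ)
    fun i _ => nml_concave (hp i) (hq i) h0 h1
  simpa only [shannon, Finset.sum_add_distrib, ← Finset.mul_sum] using hs

lemma prob_nonneg {n : Type*} [Fintype n] [DecidableEq n] {ρ P : Matrix n n ℂ}
    (hρ : IsState ρ) (hP : IsRankOneProj P) : 0 ≤ (ρ * P).trace.re := by
  have h := (hρ.1.conjTranspose_mul_mul_same P).trace_nonneg
  rw [hP.1.eq, Matrix.trace_mul_comm, ← Matrix.mul_assoc, hP.2.1, Matrix.trace_mul_comm] at h
  exact (Complex.le_def.1 h).1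

lemma prob_sum {d : ℕ} {ρ : Matrix (Fin d × Fin d) (Fin d × Fin d) ℂ}
    {P : Fin (d^2) → Matrix (Fin d × Fin d) (Fin d × Fin d) ℂ}
    (hρ : IsState ρ) (hP : IsMeasurement P) : ∑ i, (ρ * P i).trace.re = 1 := by
  rw [← Complex.re_sum, ← Matrix.trace_sum, ← Matrix.mul_sum, hP.2.2, Matrix.mul_one, hρ.2]
  rfl

lemma klein_diff {d : ℕ} (hd : 2 ≤ d) {ρ σ : Matrix (Fin d × Fin d) (Fin d × Fin d) ℂ}
    (hρ : IsState ρ) (hσ : IsState σ)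
    {ε : ℝ} (hε0 : 0 ≤ ε) (hε1 : ε ≤ 1)
    {P : Fin (d^2) → Matrix (Fin d × Fin d) (Fin d × Fin d) ℂ} (hP : IsMeasurement P) :
    |kleinEntropy ρ P - kleinEntropy (((1 - ε : ℝ) : ℂ) • ρ + ((ε : ℝ) : ℂ) • σ) P| ≤
      4 * ε * Real.logb 2 d + binEnt ε := by
  have hmix : kleinEntropy (((1 - ε : ℝ) : ℂ) • ρ + ((ε : ℝ) : ℂ) • σ) P =
      shannon (fun i => (1 - ε) * (ρ * P i).trace.re + ε * (σ * P i).trace.re) := by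
    simp only [kleinEntropy]
    congr 1; funext i
    rw [Matrix.add_mul, Matrix.smul_mul, Matrix.smul_mul, Matrix.trace_add, Matrix.trace_smul,
      Matrix.trace_smul, Complex.add_re, smul_eq_mul, smul_eq_mul, Complex.re_ofReal_mul,
      Complex.re_ofReal_mul]
  rw [hmix]
  have hp : ∀ i, 0 ≤ (ρ * P i).trace.re := fun i => prob_nonneg hρ (hP.1 i)
  have hq : ∀ i, 0 ≤ (σ * P i).trace.re := fun i => prob_nonneg hσ (hP.1 i)
  have hp1 := prob_sum hρ hP
  have hq1 := prob_sum hσ hP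
  have hN : 0 < d ^ 2 := by positivity
  have u := shannon_mix_le hp hq hp1 hq1 hε0 hε1
  have l := le_shannon_mix hp hq hε0 hε1
  have a1 := shannon_nonneg hp hp1
  have a2 := shannon_nonneg hq hq1
  have b1 := shannon_le hN hp hp1
  have b2 := shannon_le hN hq hq1
  have hl : Real.logb 2 ((d ^ 2 : ℕ) : ℝ) = 2 * Real.logb 2 d := by
    push_cast
    rw [Real.logb_pow]; norm_num
  rw [hl] at b1 b2
  have hL : 0 ≤ Real.logb 2 d := by linarith
  have hb : 0 ≤ binEnt ε :=
    add_nonneg (nml_nonneg hε0 hε1) (nml_nonneg (by linarith) (by linarith))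
  simp only [kleinEntropy]
  rw [abs_le]
  constructor <;> nlinarith [mul_le_mul_of_nonneg_left b1 hε0, mul_le_mul_of_nonneg_left b2 hε0,
    mul_nonneg hε0 a1, mul_nonneg hε0 a2, mul_nonneg hε0 hL]

lemma sSup_close {ι : Type*} (S : ι → Prop) (f g : ι → ℝ) {C : ℝ} (hC : 0 ≤ C)
    (h : ∀ i, S i → |f i - g i| ≤ C) :
    |sSup {x | ∃ i, S i ∧ x = f i} - sSup {x | ∃ i, S i ∧ x = g i}| ≤ C := by
  have bdd : ∀ f g : ι → ℝ, (∀ i, S i → |f i - g i| ≤ C) →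
      BddAbove {x | ∃ i, S i ∧ x = f i} → BddAbove {x | ∃ i, S i ∧ x = g i} := by
    rintro f g h ⟨B, hB⟩
    refine ⟨B + C, ?_⟩
    rintro _ ⟨i, hi, rfl⟩
    have h1 : f i ≤ B := hB ⟨i, hi, rfl⟩
    have := (abs_le.1 (h i hi)).1
    linarith
  have half : ∀ f g : ι → ℝ, (∀ i, S i → |f i - g i| ≤ C) → (∃ i, S i) →
      BddAbove {x | ∃ i, S i ∧ x = g i} →
      sSup {x | ∃ i, S i ∧ x = f i} ≤ sSup {x | ∃ i, S i ∧ x = g i} + C := by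
    rintro f g h ⟨i, hi⟩ hb
    refine csSup_le ⟨f i, i, hi, rfl⟩ ?_
    rintro _ ⟨j, hj, rfl⟩
    have h1 := le_csSup hb ⟨j, hj, rfl⟩
    have := (abs_le.1 (h j hj)).2
    linarith
  have h' : ∀ i, S i → |g i - f i| ≤ C := fun i hi => by rw [abs_sub_comm]; exact h i hi
  by_cases hne : ∃ i, S i
  · by_cases hb : BddAbove {x | ∃ i, S i ∧ x = f i}
    · have h1 := half f g h hne (bdd f g h hb)
      have h2 := half g f h' hne hb
      rw [abs_le]; constructor <;> linarith
    · have hb' := fun hg => hb (bdd g f h' hg)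
      rw [Real.sSup_of_not_bddAbove hb, Real.sSup_of_not_bddAbove hb']
      simpa using hC
  · have e : ∀ f : ι → ℝ, {x | ∃ i, S i ∧ x = f i} = ∅ := by
      intro f; ext x; simp only [Set.mem_setOf_eq, Set.mem_empty_iff_false, iff_false]
      rintro ⟨i, hi, _⟩; exact hne ⟨i, hi⟩
    rw [e, e]; simpa using hC

/-- Robustness under admixture of the entropic entanglement parameter:
|M(ρ) − M((1−ε)ρ + εσ)| ≤ 4 ε log₂ d + H₂(ε). -/
theorem stmt19 {d : ℕ} (hd : 2 ≤ d) (ρ σ : Matrix (Fin d × Fin d) (Fin d × Fin d) ℂ)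
    (hρ : IsState ρ) (hσ : IsState σ)
    (ε : ℝ) (hε0 : 0 ≤ ε) (hε1 : ε ≤ 1) :
    |eep ρ - eep (((1 - ε : ℝ) : ℂ) • ρ + ((ε : ℝ) : ℂ) • σ)| ≤
      4 * ε * Real.logb 2 d + binEnt ε := by
  have hL : 0 ≤ Real.logb 2 (d : ℝ) :=
    Real.logb_nonneg (by norm_num) (by exact_mod_cast (by omega : 1 ≤ d))
  have hb : 0 ≤ binEnt ε :=
    add_nonneg (nml_nonneg hε0 hε1) (nml_nonneg (by linarith) (by linarith))
  refine sSup_close IsMeasurement _ _ (by positivity) ?_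
  intro P hP
  have := klein_diff hd hρ hσ hε0 hε1 hP
  rw [abs_sub_comm] at this
  convert this using 2
  ring

end EEP
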